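/- Let n ≥ 3, d = 3n+2, and let Ψ be a Clebsch covariant of degree d. If h₃ and h₄ both lie in L_T (i.e. are homogeneous of degree d and divisible by x₁^{2n+5}), then Ψ(h₁,h₂,h₃,h₄) = 0 for all h₁, h₂ ∈ V(d). (This expresses that the projectivization of L_T is contained in the base scheme of the rational map T_d : ℙV(d) ⇢ ℙV(8) with a full triple structure.) -/

import Mathlib

open MvPolynomial

noncomputable section

/-- The polynomial ring ℂ[x₁,x₂,x₃]. -/
abbrev MvP : Type := MvPolynomial (Fin 3) ℂ

/-- The linear form a₁x₁+a₂x₂+a₃x₃ with coefficient vector a. -/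
def lin (a : Fin 3 → ℂ) : MvP := ∑ i, C (a i) * X i

lemma lin_hom (a : Fin 3 → ℂ) : (lin a).IsHomogeneous 1 := by
  unfold lin
  apply IsHomogeneous.sum
  intro i _
  simpa using (isHomogeneous_C (Fin 3) (a i)).mul (isHomogeneous_X ℂ i)

/-- V(k): the space of homogeneous polynomials of degree k in ℂ[x₁,x₂,x₃]. -/
def V (k : ℕ) : Submodule ℂ MvP := homogeneousSubmodule (Fin 3) ℂ k

/-- l^d as an element of V(d), where l is the linear form with coefficient vector a. -/
def powV (d : ℕ) (a : Fin 3 → ℂ) : V d :=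
  ⟨lin a ^ d, by rw [V, mem_homogeneousSubmodule]; simpa using (lin_hom a).pow d⟩

/-- The bracket (l₁l₂l₃) = det(vec l₁, vec l₂, vec l₃). -/
def br (a b c : Fin 3 → ℂ) : ℂ := Matrix.det (Matrix.of ![a, b, c])

/-- I(l₁,l₂,l₃,l₄) = (l₁l₂l₃)(l₁l₂l₄)(l₁l₃l₄)(l₂l₃l₄). -/
def Icov (a b c d : Fin 3 → ℂ) : ℂ := br a b c * br a b d * br a c d * br b c d

/-- l₁l₂l₃l₄ as an element of V(4). -/
def prod4 (a b c d : Fin 3 → ℂ) : V 4 :=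
  ⟨lin a * lin b * lin c * lin d, by
    rw [V, mem_homogeneousSubmodule]
    simpa using (((lin_hom a).mul (lin_hom b)).mul (lin_hom c)).mul (lin_hom d)⟩

/-- l₁²l₂²l₃²l₄² as an element of V(8). -/
def prod4sq (a b c d : Fin 3 → ℂ) : V 8 :=
  ⟨lin a ^ 2 * lin b ^ 2 * lin c ^ 2 * lin d ^ 2, by
    rw [V, mem_homogeneousSubmodule]
    simpa using ((((lin_hom a).pow 2).mul ((lin_hom b).pow 2)).mul ((lin_hom c).pow 2)).mul
      ((lin_hom d).pow 2)⟩

/-- Φ is a Clebsch covariant of degree d = 3n+1: a symmetric quadrilinear map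
V(d)⁴ → V(4) with Φ(l₁^d,l₂^d,l₃^d,l₄^d) = I(l₁,l₂,l₃,l₄)^n · l₁l₂l₃l₄. -/
def IsClebschS (n : ℕ) (Φ : MultilinearMap ℂ (fun _ : Fin 4 => V (3*n+1)) (V 4)) : Prop :=
  (∀ (v : Fin 4 → V (3*n+1)) (σ : Equiv.Perm (Fin 4)), Φ (v ∘ σ) = Φ v) ∧
  (∀ a b c d : Fin 3 → ℂ,
    Φ ![powV (3*n+1) a, powV (3*n+1) b, powV (3*n+1) c, powV (3*n+1) d]
      = (Icov a b c d) ^ n • prod4 a b c d)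

/-- Ψ is a Clebsch covariant of degree d = 3n+2: a symmetric quadrilinear map
V(d)⁴ → V(8) with Ψ(l₁^d,l₂^d,l₃^d,l₄^d) = I(l₁,l₂,l₃,l₄)^n · l₁²l₂²l₃²l₄². -/
def IsClebschT (n : ℕ) (Ψ : MultilinearMap ℂ (fun _ : Fin 4 => V (3*n+2)) (V 8)) : Prop :=
  (∀ (v : Fin 4 → V (3*n+2)) (σ : Equiv.Perm (Fin 4)), Ψ (v ∘ σ) = Ψ v) ∧
  (∀ a b c d : Fin 3 → ℂ,
    Ψ ![powV (3*n+2) a, powV (3*n+2) b, powV (3*n+2) c, powV (3*n+2) d]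
      = (Icov a b c d) ^ n • prod4sq a b c d)

/-- Membership in L_S = x₁^{2n+3}·V(n−2): a homogeneous form of degree 3n+1 lies in L_S
iff it is divisible by x₁^{2n+3}. -/
def memLS (n : ℕ) (h : V (3*n+1)) : Prop := (X 0 : MvP) ^ (2*n+3) ∣ (h : MvP)

/-- Membership in L_T = x₁^{2n+5}·V(n−3): a homogeneous form of degree 3n+2 lies in L_T
iff it is divisible by x₁^{2n+5}. -/
def memLT (n : ℕ) (h : V (3*n+2)) : Prop := (X 0 : MvP) ^ (2*n+5) ∣ (h : MvP)

/-- The Lagrange interpolation polynomial p_i^b of degree K−1 evaluated at c. -/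
def interp {K : ℕ} (b : Fin K → ℂ) (i : Fin K) (c : ℂ) : ℂ :=
  ∏ j ∈ Finset.univ.erase i, (c - b j) / (b i - b j)

/-- f(c) = Σᵢ p_i^b(c)·l_i^d − (cx₁+y)^d where y = λx₂+μx₃ and l_i = b_i x₁ + y. -/
def fc {K : ℕ} (d : ℕ) (b : Fin K → ℂ) (lam mu c : ℂ) : MvP :=
  ∑ i, C (interp b i c) * lin ![b i, lam, mu] ^ d - lin ![c, lam, mu] ^ d

/-- f(c) as an element of V(d). -/
def fcV {K : ℕ} (d : ℕ) (b : Fin K → ℂ) (lam mu c : ℂ) : V d :=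
  ∑ i, interp b i c • powV d ![b i, lam, mu] - powV d ![c, lam, mu]

/-- The bracket (l₁l₂l₃) over an arbitrary commutative ring. -/
def brR {R : Type*} [CommRing R] (a b c : Fin 3 → R) : R := Matrix.det (Matrix.of ![a, b, c])

/-- I(l₁,l₂,l₃,l₄) over an arbitrary commutative ring. -/
def IcovR {R : Type*} [CommRing R] (a b c d : Fin 3 → R) : R :=
  brR a b c * brR a b d * brR a c d * brR b c d

/-- The binomial coefficient polynomial X(X−1)⋯(X−m+1)/m! over ℂ. -/
def binomPoly (m : ℕ) : Polynomial ℂ :=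
  Polynomial.C ((m.factorial : ℂ))⁻¹ * ∏ i ∈ Finset.range m, (Polynomial.X - Polynomial.C (i : ℂ))

/-- The mod-p binomial coefficient polynomial X(X−1)⋯(X−m+1)/m!. -/
def binomPolyZMod (p m : ℕ) : Polynomial (ZMod p) :=
  Polynomial.C ((m.factorial : ZMod p))⁻¹ *
    ∏ i ∈ Finset.range m, (Polynomial.X - Polynomial.C (i : ZMod p))

/-- c·x₁ + λx₂ + μx₃ as an element of (ℂ[x₁,x₂,x₃])[c]. -/
def cLin (lam mu : ℂ) : Polynomial MvP :=
  Polynomial.X * Polynomial.C (X 0) + Polynomial.C (C lam * X 1 + C mu * X 2)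

/-- G_n = −24 Σ_{i<k<p} I(cx₁+y, m_i, m_k, m_p)^n·(cx₁+y)·m_i m_k m_p ∈ ℂ[c,x₁,x₂,x₃],
viewed as a polynomial in c with coefficients in ℂ[x₁,x₂,x₃]. -/
def Gpoly {N : ℕ} (m : Fin N → Fin 3 → ℂ) (lam mu : ℂ) (n : ℕ) : Polynomial MvP :=
  (-24 : Polynomial MvP) *
    ∑ i, ∑ k, ∑ p,
      if i < k ∧ k < p then
        Polynomial.map (MvPolynomial.C)
          ((IcovR ![Polynomial.X, Polynomial.C lam, Polynomial.C mu]
            (fun j => Polynomial.C (m i j)) (fun j => Polynomial.C (m k j))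
            (fun j => Polynomial.C (m p j))) ^ n)
        * cLin lam mu * Polynomial.C (lin (m i) * lin (m k) * lin (m p))
      else 0

/-- The nine linear forms m₁,…,m₉ (coefficient vectors). -/
def ms : Fin 9 → Fin 3 → ℂ :=
  ![![1, 3, 9], ![-10, 1, 4], ![8, 4, 6],
    ![1, 6, -10], ![4, -8, -10], ![-3, 7, -4],
    ![0, -3, 2], ![8, -4, -4], ![-10, 4, 6]]

lemma powV_span (d : ℕ) : Submodule.span ℂ (Set.range (powV d)) = ⊤ := by
  by_contra hne
  obtain ⟨x, hx⟩ : ∃ x, x ∉ Submodule.span ℂ (Set.range (powV d)) := by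
    by_contra h
    push Not at h
    exact hne (Submodule.eq_top_iff'.2 h)
  have hx' : (x : MvP) ∉ Submodule.span ℂ (Set.range fun a => lin a ^ d) := by
    intro h
    apply hx
    have : (Set.range fun a => lin a ^ d) = (V d).subtype '' (Set.range (powV d)) := by
      rw [← Set.range_comp]; rfl
    rw [this, ← Submodule.map_span] at h
    obtain ⟨y, hy, hyx⟩ := h
    have : y = x := Subtype.ext hyx
    rwa [← this]
  obtain ⟨f, hf, hker⟩ := Submodule.exists_le_ker_of_notMem hx'
  have hz : ∀ a, f (lin a ^ d) = 0 := fun a => hker (Submodule.subset_span ⟨a, rfl⟩)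
  let E : (Fin 3 → ℕ) → (Fin 3 →₀ ℕ) := Finsupp.equivFunOnFinite.symm
  let P : MvP := ∑ k ∈ Finset.univ.piAntidiag d,
    monomial (E k) ((Nat.multinomial Finset.univ k : ℂ) * f (monomial (E k) 1))
  have hP : P = 0 := by
    apply MvPolynomial.funext
    intro a
    rw [map_zero, ← hz a, lin, Finset.sum_pow_eq_sum_piAntidiag, map_sum, map_sum]
    apply Finset.sum_congr rfl
    intro k _
    have : (Nat.multinomial Finset.univ k : MvP) * ∏ i, (C (a i) * X i) ^ k i
        = ((Nat.multinomial Finset.univ k : ℂ) * ∏ i, a i ^ k i) • monomial (E k) (1 : ℂ) := by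
      rw [monomial_eq, Finsupp.prod_fintype _ _ (by simp), smul_eq_C_mul]
      simp [Finset.prod_mul_distrib, mul_pow, E, mul_assoc]
    rw [this, map_smul, eval_monomial, Finsupp.prod_fintype _ _ (by simp)]
    simp [E]
    ring
  apply hf
  rw [(x : MvP).as_sum, map_sum]
  apply Finset.sum_eq_zero
  intro k hk
  have hxh : (x : MvP).IsHomogeneous d := x.2
  have hkd : k.degree = d := by
    have := hxh (mem_support_iff.1 hk)
    rw [Finsupp.degree_eq_weight_one]; exact this
  have h1 : coeff k P = 0 := by rw [hP]; simp
  have hmem : (k : Fin 3 → ℕ) ∈ (Finset.univ : Finset (Fin 3)).piAntidiag d := by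
    rw [Finset.mem_piAntidiag]
    refine ⟨?_, by simp⟩
    rw [← hkd, Finsupp.degree_eq_sum]
  have hEk : E k = k := by ext; rfl
  have h2 : (Nat.multinomial Finset.univ k : ℂ) * f (monomial k 1) = 0 := by
    rw [← h1, coeff_sum, Finset.sum_eq_single (k : Fin 3 → ℕ)]
    · simp [hEk]
    · intro b _ hb
      rw [coeff_monomial, if_neg]
      intro h
      apply hb
      rw [← h]; rfl
    · intro h; exact absurd hmem h
  have h3 : f (monomial k 1) = 0 := by
    rcases mul_eq_zero.1 h2 with h | h
    · exact absurd (Nat.cast_eq_zero.1 h) (Nat.multinomial_pos _ _).ne'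
    · exact h
  have : monomial k (coeff k (x : MvP)) = coeff k (x : MvP) • monomial k (1 : ℂ) := by
    simp [smul_monomial]
  rw [this, map_smul, h3, smul_zero]

/-- scaling of the first variable -/
def scA (t : ℂ) : MvP →ₐ[ℂ] MvP := aeval ![C t * X 0, X 1, X 2]

def scV (d : ℕ) (t : ℂ) : V d →ₗ[ℂ] V d :=
  (scA t).toLinearMap.restrict (by
    intro p hp
    have h : IsHomogeneous p d := hp
    have := h.aeval (S := ℂ) (n := 1) (![C t * X 0, X 1, X 2] : Fin 3 → MvP) (by
      intro i
      fin_cases i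
      · simpa using (isHomogeneous_C (Fin 3) t).mul (isHomogeneous_X ℂ 0)
      · exact isHomogeneous_X ℂ 1
      · exact isHomogeneous_X ℂ 2)
    rw [one_mul] at this
    exact this)

def scc (t : ℂ) (c : Fin 3 → ℂ) : Fin 3 → ℂ := ![t * c 0, c 1, c 2]

lemma scV_powV (d : ℕ) (t : ℂ) (c : Fin 3 → ℂ) : scV d t (powV d c) = powV d (scc t c) := by
  apply Subtype.ext
  change scA t (lin c ^ d) = lin (scc t c) ^ d
  rw [map_pow]
  congr 1
  simp [lin, scA, scc, Fin.sum_univ_three, algebraMap_eq]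
  ring

/-- polynomial dependence on t of degree at most N -/
def Good (N : ℕ) (F : ℂ → MvP) : Prop :=
  ∃ P : Polynomial MvP, P.natDegree ≤ N ∧ ∀ t, P.eval (C t) = F t

lemma Good.mul {N M : ℕ} {F G : ℂ → MvP} (hF : Good N F) (hG : Good M G) :
    Good (N + M) (fun t => F t * G t) := by
  obtain ⟨P, hP, hP'⟩ := hF
  obtain ⟨Q, hQ, hQ'⟩ := hG
  exact ⟨P * Q, Polynomial.natDegree_mul_le_of_le hP hQ, fun t => by simp [hP', hQ']⟩

lemma Good.add {N : ℕ} {F G : ℂ → MvP} (hF : Good N F) (hG : Good N G) :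
    Good N (fun t => F t + G t) := by
  obtain ⟨P, hP, hP'⟩ := hF
  obtain ⟨Q, hQ, hQ'⟩ := hG
  exact ⟨P + Q, Polynomial.natDegree_add_le_of_degree_le hP hQ, fun t => by simp [hP', hQ']⟩

lemma Good.pow {N : ℕ} {F : ℂ → MvP} (hF : Good N F) (k : ℕ) :
    Good (k * N) (fun t => F t ^ k) := by
  obtain ⟨P, hP, hP'⟩ := hF
  exact ⟨P ^ k, Polynomial.natDegree_pow_le_of_le k hP, fun t => by simp [hP']⟩

lemma good_const (f : MvP) : Good 0 (fun _ => f) := ⟨Polynomial.C f, by simp, by simp⟩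

lemma good_lin (f g : MvP) : Good 1 (fun t => f * C t + g) :=
  ⟨Polynomial.C f * Polynomial.X + Polynomial.C g, Polynomial.natDegree_linear_le, by simp⟩

lemma good_span {d N : ℕ} (F : ℂ → (V d →ₗ[ℂ] V 8))
    (h : ∀ c, Good N (fun t => (F t (powV d c) : MvP))) (p : V d) :
    Good N (fun t => (F t p : MvP)) := by
  have hp : p ∈ Submodule.span ℂ (Set.range (powV d)) := by rw [powV_span]; trivial
  induction hp using Submodule.span_induction with
  | mem x hx => obtain ⟨c, rfl⟩ := hx; exact h c
  | zero => exact ⟨0, by simp, by simp⟩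
  | add x y _ _ hx hy => simpa using hx.add hy
  | smul r x _ hx =>
    have := (good_const (C r)).mul hx
    simpa [smul_eq_C_mul] using this

lemma good_main {n : ℕ} (Ψ : MultilinearMap ℂ (fun _ : Fin 4 => V (3*n+2)) (V 8))
    (hΨ : IsClebschT n Ψ) (h₁ h₂ p q : V (3*n+2)) :
    Good (4*n+4) (fun t => (Ψ ![h₁, h₂, scV _ t p, scV _ t q] : MvP)) := by
  have e0 : ∀ (a b c d x : V (3*n+2)), Function.update ![a, b, c, d] 0 x = ![x, b, c, d] := by
    intros; ext i; fin_cases i <;> rfl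
  have e1 : ∀ (a b c d x : V (3*n+2)), Function.update ![a, b, c, d] 1 x = ![a, x, c, d] := by
    intros; ext i; fin_cases i <;> rfl
  have e2 : ∀ (a b c d x : V (3*n+2)), Function.update ![a, b, c, d] 2 x = ![a, b, x, d] := by
    intros; ext i; fin_cases i <;> rfl
  have e3 : ∀ (a b c d x : V (3*n+2)), Function.update ![a, b, c, d] 3 x = ![a, b, c, x] := by
    intros; ext i; fin_cases i <;> rfl
  have := good_span (N := 4*n+4) (fun t => Ψ.toLinearMap ![0, h₂, scV _ t p, scV _ t q] 0) ?_ h₁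
  · simpa only [MultilinearMap.toLinearMap_apply, e0] using this
  intro a
  simp only [MultilinearMap.toLinearMap_apply, e0]
  have := good_span (N := 4*n+4) (fun t => Ψ.toLinearMap ![powV _ a, 0, scV _ t p, scV _ t q] 1) ?_ h₂
  · simpa only [MultilinearMap.toLinearMap_apply, e1] using this
  intro b
  simp only [MultilinearMap.toLinearMap_apply, e1]
  have := good_span (N := 4*n+4)
    (fun t => Ψ.toLinearMap ![powV _ a, powV _ b, 0, scV _ t q] 2 ∘ₗ scV _ t) ?_ p
  · simpa only [LinearMap.comp_apply, MultilinearMap.toLinearMap_apply, e2] using this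
  intro c
  simp only [LinearMap.comp_apply, MultilinearMap.toLinearMap_apply, e2]
  have := good_span (N := 4*n+4)
    (fun t => Ψ.toLinearMap ![powV _ a, powV _ b, scV _ t (powV _ c), 0] 3 ∘ₗ scV _ t) ?_ q
  · simpa only [LinearMap.comp_apply, MultilinearMap.toLinearMap_apply, e3] using this
  intro d
  simp only [LinearMap.comp_apply, MultilinearMap.toLinearMap_apply, e3, scV_powV, hΨ.2]
  have l : ∀ c, Good 1 (fun t => lin (scc t c)) := by
    intro c
    convert good_lin (C (c 0) * X 0) (C (c 1) * X 1 + C (c 2) * X 2) using 2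
    simp [lin, scc, Fin.sum_univ_three]; ring
  have b1 : ∀ c, Good 1 (fun t => C (br a b (scc t c))) := by
    intro c
    convert good_lin (C (c 0 * (a 1 * b 2 - a 2 * b 1)))
      (C (c 1 * (a 2 * b 0 - a 0 * b 2) + c 2 * (a 0 * b 1 - a 1 * b 0))) using 2
    rw [← C_mul, ← C_add]
    refine congrArg C ?_
    simp [br, scc, Matrix.det_fin_three]; ring
  have b2 : ∀ a, Good 1 (fun t => C (br a (scc t c) (scc t d))) := by
    intro a
    convert good_lin (C (c 0 * (d 1 * a 2 - d 2 * a 1) + d 0 * (a 1 * c 2 - a 2 * c 1)))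
      (C (a 0 * (c 1 * d 2 - c 2 * d 1))) using 2
    rw [← C_mul, ← C_add]
    refine congrArg C ?_
    simp [br, scc, Matrix.det_fin_three]; ring
  have h := ((((b1 c).mul (b1 d)).mul (b2 a)).mul (b2 b)).pow n
  have h' := ((good_const (lin a ^ 2 * lin b ^ 2)).mul ((l c).pow 2)).mul ((l d).pow 2)
  have := h.mul h'
  have e : n * (1 + 1 + 1 + 1) + (0 + 2 * 1 + 2 * 1) = 4*n+4 := by ring
  rw [e] at this
  convert this using 2
  simp [prod4sq, Icov, smul_eq_C_mul]

lemma good_zero {N k : ℕ} (hk : N < k) (v : MvP) (h : Good N (fun t => C t ^ k * v)) : v = 0 := by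
  obtain ⟨P, hP, hP'⟩ := h
  have : P = Polynomial.C v * Polynomial.X ^ k := by
    apply Polynomial.eq_of_infinite_eval_eq
    apply (Set.infinite_range_of_injective (C_injective (Fin 3) ℂ)).mono
    rintro _ ⟨t, rfl⟩
    rw [Set.mem_ofPred_eq, hP', Polynomial.eval_mul, Polynomial.eval_C, Polynomial.eval_pow,
      Polynomial.eval_X, mul_comm]
  have h2 := Polynomial.coeff_eq_zero_of_natDegree_lt (lt_of_le_of_lt hP hk)
  rw [this] at h2
  simpa using h2

lemma memLT_span {n : ℕ} (h : V (3*n+2)) (hT : memLT n h) :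
    h ∈ Submodule.span ℂ {q : V (3*n+2) | ∃ k, 2*n+5 ≤ k ∧ ∀ t, scV _ t q = t ^ k • q} := by
  have hh : (h : MvP).IsHomogeneous (3*n+2) := h.2
  have hs : h = ∑ k ∈ (h : MvP).support.attach,
      (⟨monomial k.1 (coeff k.1 (h : MvP)), by
        apply isHomogeneous_monomial
        have := hh (mem_support_iff.1 k.2)
        rw [Finsupp.degree_eq_weight_one]; exact this⟩ : V (3*n+2)) := by
    apply Subtype.ext
    rw [Submodule.coe_sum]
    conv_lhs => rw [(h : MvP).as_sum]
    exact (Finset.sum_attach _ (fun k => monomial k (coeff k (h : MvP)))).symm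
  rw [hs]
  apply Submodule.sum_mem
  rintro ⟨k, hk⟩ _
  apply Submodule.subset_span
  refine ⟨k 0, ?_, ?_⟩
  · obtain ⟨g, hg⟩ := hT
    by_contra hlt
    rw [mem_support_iff, hg, X_pow_eq_monomial, coeff_monomial_mul', if_neg] at hk
    · exact hk rfl
    · intro hle
      have := hle 0
      simp at this
      omega
  · intro t
    apply Subtype.ext
    change scA t (monomial k _) = t ^ (k 0) • monomial k _
    rw [scA, aeval_monomial, monomial_eq, Finsupp.prod_fintype _ _ (by simp),
      Finsupp.prod_fintype _ _ (by simp), smul_eq_C_mul]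
    simp [Fin.prod_univ_three, algebraMap_eq]
    ring

theorem stmt7 (n : ℕ) (hn : 3 ≤ n)
    (Ψ : MultilinearMap ℂ (fun _ : Fin 4 => V (3*n+2)) (V 8)) (hΨ : IsClebschT n Ψ)
    (h₃ h₄ : V (3*n+2)) (h₃T : memLT n h₃) (h₄T : memLT n h₄) :
    ∀ h₁ h₂ : V (3*n+2), Ψ ![h₁, h₂, h₃, h₄] = 0 := by
  intro h₁ h₂
  have key : ∀ p q : V (3*n+2), (∃ k, 2*n+5 ≤ k ∧ ∀ t, scV _ t p = t ^ k • p) →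
      (∃ k, 2*n+5 ≤ k ∧ ∀ t, scV _ t q = t ^ k • q) → Ψ ![h₁, h₂, p, q] = 0 := by
    rintro p q ⟨k, hk, hp⟩ ⟨l, hl, hq⟩
    have := good_main Ψ hΨ h₁ h₂ p q
    apply Subtype.ext
    apply good_zero (show 4*n+4 < k + l by omega)
    convert this using 2 with t
    have e2 := Ψ.map_update_smul ![h₁, h₂, 0, t ^ l • q] 2 (t ^ k) p
    have e3 := Ψ.map_update_smul ![h₁, h₂, p, 0] 3 (t ^ l) q
    have a2 : ∀ a b c d x : V (3*n+2), Function.update ![a, b, c, d] 2 x = ![a, b, x, d] := by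
      intros; ext i; fin_cases i <;> rfl
    have a3 : ∀ a b c d x : V (3*n+2), Function.update ![a, b, c, d] 3 x = ![a, b, c, x] := by
      intros; ext i; fin_cases i <;> rfl
    rw [a2, a2] at e2
    rw [a3, a3] at e3
    rw [hp, hq, e2, e3]
    simp [smul_eq_C_mul, pow_add, mul_assoc]
  have a2 : ∀ a b c d x : V (3*n+2), Function.update ![a, b, c, d] 2 x = ![a, b, x, d] := by
    intros; ext i; fin_cases i <;> rfl
  have a3 : ∀ a b c d x : V (3*n+2), Function.update ![a, b, c, d] 3 x = ![a, b, c, x] := by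
    intros; ext i; fin_cases i <;> rfl
  have s3 : ∀ q : V (3*n+2), (∃ k, 2*n+5 ≤ k ∧ ∀ t, scV _ t q = t ^ k • q) →
      Ψ ![h₁, h₂, h₃, q] = 0 := by
    intro q hq
    have hle : Submodule.span ℂ {q : V (3*n+2) | ∃ k, 2*n+5 ≤ k ∧ ∀ t, scV _ t q = t ^ k • q}
        ≤ LinearMap.ker (Ψ.toLinearMap ![h₁, h₂, 0, q] 2) := by
      rw [Submodule.span_le]
      intro p hp
      have := key p q hp hq
      simpa only [SetLike.mem_coe, LinearMap.mem_ker, MultilinearMap.toLinearMap_apply, a2] using this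
    have := hle (memLT_span h₃ h₃T)
    simpa only [LinearMap.mem_ker, MultilinearMap.toLinearMap_apply, a2] using this
  have hle : Submodule.span ℂ {q : V (3*n+2) | ∃ k, 2*n+5 ≤ k ∧ ∀ t, scV _ t q = t ^ k • q}
      ≤ LinearMap.ker (Ψ.toLinearMap ![h₁, h₂, h₃, 0] 3) := by
    rw [Submodule.span_le]
    intro q hq
    have := s3 q hq
    simpa only [SetLike.mem_coe, LinearMap.mem_ker, MultilinearMap.toLinearMap_apply, a3] using this
  have := hle (memLT_span h₄ h₄T)
  simpa only [LinearMap.mem_ker, MultilinearMap.toLinearMap_apply, a3] using this
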